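/- arXiv:2407.17323 — 5 statements merged into one kernel-verified Lean document; each statement's English description precedes it below -/
import Mathlib

section
/- Let (A, ·_{α,β}, R_ω, p_ω, q_ω) be a Rota-Baxter family BiHom-Ω-associative algebra of weight λ. Define a ⋆_{α,β} b := a ·_{α,β} R_β(b) + R_α(a) ·_{α,β} b + λ a ·_{α,β} b. Then (A, ⋆_{α,β}, p_ω, q_ω) is a BiHom-Ω-associative algebra, i.e., p_{αβ}(a ⋆_{α,β} b) = p_α(a) ⋆_{α,β} p_β(b), q_{αβ}(a ⋆_{α,β} b) = q_α(a) ⋆_{α,β} q_β(b), and p_α(a) ⋆_{α,βγ} (b ⋆_{β,γ} c) = (a ⋆_{α,β} b) ⋆_{αβ,γ} q_γ(c) for all a,b,c ∈ A and α,β,γ ∈ Ω. -/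
/-- A BiHom-`Ω`-associative algebra structure. -/
def IsBiHomAssoc {k Ω A : Type*} [CommRing k] [Semigroup Ω]
    [AddCommGroup A] [Module k A]
    (mul : Ω → Ω → A →ₗ[k] A →ₗ[k] A) (p q : Ω → A →ₗ[k] A) : Prop :=
  (∀ α β x, p α (q β x) = q β (p α x)) ∧
  (∀ α β x y, p (α * β) (mul α β x y) = mul α β (p α x) (p β y)) ∧
  (∀ α β x y, q (α * β) (mul α β x y) = mul α β (q α x) (q β y)) ∧
  (∀ α β γ x y z,
    mul α (β * γ) (p α x) (mul β γ y z) = mul (α * β) γ (mul α β x y) (q γ z))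

/-- The `⋆`-product associated with a Rota-Baxter family:
`a ⋆_{α,β} b = a ·_{α,β} R_β(b) + R_α(a) ·_{α,β} b + λ a ·_{α,β} b`. -/
def starMul {k Ω A : Type*} [CommRing k] [Semigroup Ω]
    [AddCommGroup A] [Module k A] (lam : k)
    (mul : Ω → Ω → A →ₗ[k] A →ₗ[k] A) (R : Ω → A →ₗ[k] A)
    (α β : Ω) : A →ₗ[k] A →ₗ[k] A :=
  (mul α β).compl₂ (R β) + (mul α β).comp (R α) + lam • mul α β

theorem starMul_apply {k Ω A : Type*} [CommRing k] [Semigroup Ω]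
    [AddCommGroup A] [Module k A] (lam : k)
    (mul : Ω → Ω → A →ₗ[k] A →ₗ[k] A) (R : Ω → A →ₗ[k] A) (α β : Ω) (x y : A) :
    starMul lam mul R α β x y
      = mul α β x (R β y) + mul α β (R α x) y + lam • mul α β x y :=
  rfl

/-- A Rota-Baxter family turns the `⋆`-product into the original product. -/
theorem map_starMul {k Ω A : Type*} [CommRing k] [Semigroup Ω]
    [AddCommGroup A] [Module k A] {lam : k}
    {mul : Ω → Ω → A →ₗ[k] A →ₗ[k] A} {R : Ω → A →ₗ[k] A}
    (hRB : ∀ α β x y,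
      mul α β (R α x) (R β y)
        = R (α * β) (mul α β (R α x) y) + R (α * β) (mul α β x (R β y))
          + lam • R (α * β) (mul α β x y)) (α β : Ω) (x y : A) :
    R (α * β) (starMul lam mul R α β x y) = mul α β (R α x) (R β y) := by
  rw [hRB, starMul_apply, map_add, map_add, map_smul,
    add_comm (R (α * β) (mul α β x (R β y)))]

/-- If `(A, mul, R, p, q)` is a Rota-Baxter family
BiHom-`Ω`-associative algebra of weight `λ`, then `(A, ⋆, p, q)` is again a
BiHom-`Ω`-associative algebra. -/
theorem starMul_isBiHomAssoc
    {k Ω A : Type*} [CommRing k] [Semigroup Ω] [AddCommGroup A] [Module k A]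
    (lam : k)
    (mul : Ω → Ω → A →ₗ[k] A →ₗ[k] A) (R p q : Ω → A →ₗ[k] A)
    (hA : IsBiHomAssoc mul p q)
    (hpR : ∀ ω x, p ω (R ω x) = R ω (p ω x))
    (hqR : ∀ ω x, q ω (R ω x) = R ω (q ω x))
    (hRB : ∀ α β x y,
      mul α β (R α x) (R β y)
        = R (α * β) (mul α β (R α x) y) + R (α * β) (mul α β x (R β y))
          + lam • R (α * β) (mul α β x y)) :
    IsBiHomAssoc (starMul lam mul R) p q := by
  obtain ⟨hpq, hp, hq, hassoc⟩ := hA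
  refine ⟨hpq, fun α β x y => ?_, fun α β x y => ?_, fun α β γ x y z => ?_⟩
  · simp only [starMul_apply, map_add, map_smul, hp, hpR]
  · simp only [starMul_apply, map_add, map_smul, hq, hqR]
  · rw [starMul_apply lam mul R α (β * γ), starMul_apply lam mul R (α * β) γ,
      map_starMul hRB, map_starMul hRB, ← hpR, ← hqR]
    simp only [starMul_apply, map_add, map_smul, LinearMap.add_apply,
      LinearMap.smul_apply, hassoc, smul_add]
    abel
end

section
/- Let (A, ·_{α,β}, R_ω, p_ω, q_ω) be a Rota-Baxter family BiHom-Ω-associative algebra of weight λ, and (M, ▷_{α,β}, ◁_{α,β}, T_ω, p^M_ω, q^M_ω) a Rota-Baxter family BiHom-Ω-bimodule over A. Define a ◀▶_{α,β}: a ▸_{α,β} m := R_α(a) ▷_{α,β} m − T_{αβ}(a ▷_{α,β} m) and m ◂_{α,β} a := m ◁_{α,β} R_β(a) − T_{αβ}(m ◁_{α,β} a). Then (M, ▸_{α,β}, ◂_{α,β}, p^M_ω, q^M_ω) is a bimodule over the BiHom-Ω-associative algebra A_⋆ = (A, ⋆_{α,β}, p_ω, q_ω), where a ⋆_{α,β}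 b = a ·_{α,β} R_β(b) + R_α(a) ·_{α,β} b + λ a ·_{α,β} b. -/
/-- A bimodule over a BiHom-`Ω`-associative algebra. -/
def IsBiHomBimodule {k Ω A M : Type*} [CommRing k] [Semigroup Ω]
    [AddCommGroup A] [Module k A] [AddCommGroup M] [Module k M]
    (mul : Ω → Ω → A →ₗ[k] A →ₗ[k] A) (p q : Ω → A →ₗ[k] A)
    (l : Ω → Ω → A →ₗ[k] M →ₗ[k] M) (r : Ω → Ω → M →ₗ[k] A →ₗ[k] M)
    (pM qM : Ω → M →ₗ[k] M) : Prop :=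
  (∀ α β x m, pM (α * β) (l α β x m) = l α β (p α x) (pM β m)) ∧
  (∀ α β x m, qM (α * β) (l α β x m) = l α β (q α x) (qM β m)) ∧
  (∀ α β γ x x' m,
    l α (β * γ) (p α x) (l β γ x' m) = l (α * β) γ (mul α β x x') (qM γ m)) ∧
  (∀ α β m x, pM (α * β) (r α β m x) = r α β (pM α m) (p β x)) ∧
  (∀ α β m x, qM (α * β) (r α β m x) = r α β (qM α m) (q β x)) ∧
  (∀ α β γ m x x',
    r α (β * γ) (pM α m) (mul β γ x x') = r (α * β) γ (r α β m x) (q γ x')) ∧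
  (∀ α β γ x m x',
    l α (β * γ) (p α x) (r β γ m x') = r (α * β) γ (l α β x m) (q γ x'))

/-- The deformed left action `a ▸_{α,β} m = R_α(a) ▷_{α,β} m − T_{αβ}(a ▷_{α,β} m)`. -/
def starLeft {k Ω A M : Type*} [CommRing k] [Semigroup Ω]
    [AddCommGroup A] [Module k A] [AddCommGroup M] [Module k M]
    (l : Ω → Ω → A →ₗ[k] M →ₗ[k] M) (R : Ω → A →ₗ[k] A) (T : Ω → M →ₗ[k] M)
    (α β : Ω) : A →ₗ[k] M →ₗ[k] M :=
  (l α β).comp (R α) - (l α β).compr₂ (T (α * β))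

/-- The deformed right action `m ◂_{α,β} a = m ◁_{α,β} R_β(a) − T_{αβ}(m ◁_{α,β} a)`. -/
def starRight {k Ω A M : Type*} [CommRing k] [Semigroup Ω]
    [AddCommGroup A] [Module k A] [AddCommGroup M] [Module k M]
    (r : Ω → Ω → M →ₗ[k] A →ₗ[k] M) (R : Ω → A →ₗ[k] A) (T : Ω → M →ₗ[k] M)
    (α β : Ω) : M →ₗ[k] A →ₗ[k] M :=
  (r α β).compl₂ (R β) - (r α β).compr₂ (T (α * β))

theorem starLeft_apply {k Ω A M : Type*} [CommRing k] [Semigroup Ω]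
    [AddCommGroup A] [Module k A] [AddCommGroup M] [Module k M]
    (l : Ω → Ω → A →ₗ[k] M →ₗ[k] M) (R : Ω → A →ₗ[k] A) (T : Ω → M →ₗ[k] M)
    (α β : Ω) (x : A) (m : M) :
    starLeft l R T α β x m = l α β (R α x) m - T (α * β) (l α β x m) :=
  rfl

theorem starRight_apply {k Ω A M : Type*} [CommRing k] [Semigroup Ω]
    [AddCommGroup A] [Module k A] [AddCommGroup M] [Module k M]
    (r : Ω → Ω → M →ₗ[k] A →ₗ[k] M) (R : Ω → A →ₗ[k] A) (T : Ω → M →ₗ[k] M)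
    (α β : Ω) (m : M) (x : A) :
    starRight r R T α β m x = r α β m (R β x) - T (α * β) (r α β m x) :=
  rfl

/-- If `(A, mul, R, p, q)` is a Rota-Baxter family
BiHom-`Ω`-associative algebra of weight `λ` and `(M, l, r, T, pM, qM)` is a
Rota-Baxter family BiHom-`Ω`-bimodule over `A`, then `M` with the deformed
actions is a bimodule over `(A, ⋆, p, q)`. -/
theorem starActions_isBimodule
    {k Ω A M : Type*} [CommRing k] [Semigroup Ω]
    [AddCommGroup A] [Module k A] [AddCommGroup M] [Module k M]
    (lam : k)
    (mul : Ω → Ω → A →ₗ[k] A →ₗ[k] A) (R p q : Ω → A →ₗ[k] A)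
    (l : Ω → Ω → A →ₗ[k] M →ₗ[k] M) (r : Ω → Ω → M →ₗ[k] A →ₗ[k] M)
    (T pM qM : Ω → M →ₗ[k] M)
    -- `(A, mul, p, q)` is a BiHom-`Ω`-associative algebra
    (hpq : ∀ α β x, p α (q β x) = q β (p α x))
    (hpmul : ∀ α β x y, p (α * β) (mul α β x y) = mul α β (p α x) (p β y))
    (hqmul : ∀ α β x y, q (α * β) (mul α β x y) = mul α β (q α x) (q β y))
    (hassoc : ∀ α β γ x y z,
      mul α (β * γ) (p α x) (mul β γ y z) = mul (α * β) γ (mul α β x y) (q γ z))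
    -- Rota-Baxter family of weight `λ`
    (hpR : ∀ ω x, p ω (R ω x) = R ω (p ω x))
    (hqR : ∀ ω x, q ω (R ω x) = R ω (q ω x))
    (hRB : ∀ α β x y,
      mul α β (R α x) (R β y)
        = R (α * β) (mul α β (R α x) y) + R (α * β) (mul α β x (R β y))
          + lam • R (α * β) (mul α β x y))
    -- `M` is a bimodule over `A`
    (hM : IsBiHomBimodule mul p q l r pM qM)
    -- `T` commutes with the structure maps of `M`
    (hpT : ∀ ω m, pM ω (T ω m) = T ω (pM ω m))
    (hqT : ∀ ω m, qM ω (T ω m) = T ω (qM ω m))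
    -- Rota-Baxter family BiHom-`Ω`-bimodule conditions
    (hTl : ∀ α β a m,
      l α β (R α a) (T β m)
        = T (α * β) (l α β a (T β m) + l α β (R α a) m + lam • l α β a m))
    (hTr : ∀ α β m a,
      r α β (T α m) (R β a)
        = T (α * β) (r α β m (R β a) + r α β (T α m) a + lam • r α β m a)) :
    IsBiHomBimodule (starMul lam mul R) p q
      (starLeft l R T) (starRight r R T) pM qM := by
  obtain ⟨hpl, hql, hll, hpr, hqr, hrr, hlr⟩ := hM
  have hR_star (α β : Ω) (x y : A) :
      R (α * β) (starMul lam mul R α β x y) = mul α β (R α x) (R β y) := by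
    rw [starMul_apply, hRB, map_add, map_add, map_smul]
    abel
  have hTl_p (α β : Ω) (a : A) (m : M) :
      l α β (p α (R α a)) (T β m) = T (α * β) (l α β (p α a) (T β m))
        + T (α * β) (l α β (p α (R α a)) m) + lam • T (α * β) (l α β (p α a) m) := by
    rw [hpR, hTl, map_add, map_add, map_smul]
  have hTr_q (α β : Ω) (m : M) (a : A) :
      r α β (T α m) (q β (R β a)) = T (α * β) (r α β m (q β (R β a)))
        + T (α * β) (r α β (T α m) (q β a)) + lam • T (α * β) (r α β m (q β a)) := by
    rw [hqR, hTr, map_add, map_add, map_smul]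
  refine ⟨fun α β x m => ?_, fun α β x m => ?_, fun α β γ x x' m => ?_, fun α β m x => ?_,
    fun α β m x => ?_, fun α β γ m x x' => ?_, fun α β γ x m x' => ?_⟩
  · simp only [starLeft_apply, map_sub, hpl, hpT, hpR]
  · simp only [starLeft_apply, map_sub, hql, hqT, hqR]
  · rw [starLeft_apply _ _ _ (α * β), hR_star]
    simp only [starLeft_apply, starMul_apply, map_sub, map_add, map_smul, LinearMap.add_apply,
      LinearMap.smul_apply, hTl_p, ← hpR, hll, mul_assoc]
    abel
  · simp only [starRight_apply, map_sub, hpr, hpT, hpR]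
  · simp only [starRight_apply, map_sub, hqr, hqT, hqR]
  · rw [starRight_apply _ _ _ α (β * γ), hR_star]
    simp only [starRight_apply, starMul_apply, map_sub, map_add, map_smul, LinearMap.sub_apply,
      hTr_q, ← hqR, hrr, mul_assoc]
    abel
  · simp only [starLeft_apply, starRight_apply, map_sub, LinearMap.sub_apply, hTl_p, hTr_q,
      ← hpR, ← hqR, hlr, mul_assoc]
    abel
end

section
/- Let (A, μ_{α,β}, p_ω, q_ω) be a BiHom-Ω-associative algebra and M a bimodule over A. Then the coboundary operator δ_Alg defined on C^n_Ω(A,M) by (δ^n_Alg f)_{α₁,…,α_{n+1}}(a₁,…,a_{n+1}) = p^{n-1}_{α₁}(a₁) ▷_{α₁, α₂⋯α_{n+1}} f_{α₂,…,α_{n+1}}(a₂,…,a_{n+1}) + Σ_{i=1}^n (−1)^i f_{α₁,…,α_iα_{i+1},…,α_{n+1}}(p_{α₁}(a₁),…,p_{α_{i-1}}(a_{i-1}), a_i ·_{α_i,α_{i+1}} a_{i+1}, q_{α_{i+2}}(a_{i+2}),…,q_{α_{n+1}}(a_{n+1})) + (−1)^{n+1} f_{α₁,…,αₙ}(a₁,…,aₙ)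 ◁_{α₁⋯αₙ, α_{n+1}} q^{n-1}_{α_{n+1}}(a_{n+1}) satisfies δ^{n+1}_Alg ∘ δ^n_Alg = 0 for all n ≥ 1. -/
open scoped BigOperators

section

variable {k Ω A M : Type*} [CommRing k] [Monoid Ω]
  [AddCommGroup A] [Module k A] [AddCommGroup M] [Module k M]

/-- Merge the entries at positions `i` and `i+1` of a tuple in `Ω` using the product. -/
def mergeOmega {n : ℕ} (i : Fin n) (v : Fin (n + 1) → Ω) : Fin n → Ω :=
  fun j =>
    if (j : ℕ) < (i : ℕ) then v j.castSucc
    else if (j : ℕ) = (i : ℕ) then v j.castSucc * v j.succ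
    else v j.succ

/-- The argument tuple appearing in the `i`-th interior term of the BiHom-`Ω`
Hochschild-type coboundary: `p` applied before position `i`, the product at
position `i`, and `q` applied afterwards. -/
def mergeArg (mul : Ω → Ω → A →ₗ[k] A →ₗ[k] A) (p q : Ω → A →ₗ[k] A)
    {n : ℕ} (i : Fin n) (ᾱ : Fin (n + 1) → Ω) (a : Fin (n + 1) → A) : Fin n → A :=
  fun j =>
    if (j : ℕ) < (i : ℕ) then p (ᾱ j.castSucc) (a j.castSucc)
    else if (j : ℕ) = (i : ℕ) then mul (ᾱ j.castSucc) (ᾱ j.succ) (a j.castSucc) (a j.succ)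
    else q (ᾱ j.succ) (a j.succ)

/-- The coboundary operator `δ^n_Alg` of the BiHom-`Ω`-associative algebra `A` with
coefficients in a bimodule `M` (with left action `l`, right action `r`),
defined on arbitrary `n`-cochains. -/
def dAlg (mul : Ω → Ω → A →ₗ[k] A →ₗ[k] A) (p q : Ω → A →ₗ[k] A)
    (l : Ω → Ω → A →ₗ[k] M →ₗ[k] M) (r : Ω → Ω → M →ₗ[k] A →ₗ[k] M)
    (n : ℕ) (F : (Fin n → Ω) → (Fin n → A) → M) :
    (Fin (n + 1) → Ω) → (Fin (n + 1) → A) → M :=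
  fun ᾱ a =>
    l (ᾱ 0) (List.ofFn fun j : Fin n => ᾱ j.succ).prod
        ((⇑(p (ᾱ 0)))^[n - 1] (a 0))
        (F (fun j => ᾱ j.succ) (fun j => a j.succ))
      + ∑ i : Fin n, ((-1 : ℤ) ^ ((i : ℕ) + 1)) •
          F (mergeOmega i ᾱ) (mergeArg mul p q i ᾱ a)
      + ((-1 : ℤ) ^ (n + 1)) •
          r (List.ofFn fun j : Fin n => ᾱ j.castSucc).prod (ᾱ (Fin.last n))
            (F (fun j => ᾱ j.castSucc) (fun j => a j.castSucc))
            ((⇑(q (ᾱ (Fin.last n))))^[n - 1] (a (Fin.last n)))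

theorem mergeOmega_mergeOmega {n : ℕ} (i j : Fin n) (hij : i ≤ j) (v : Fin (n + 2) → Ω) :
    mergeOmega j (mergeOmega i.castSucc v) = mergeOmega i (mergeOmega j.succ v) := by
  funext t
  have hij' : (i : ℕ) ≤ j := hij
  simp only [mergeOmega, Fin.val_castSucc, Fin.val_succ, Fin.succ_castSucc]
  split_ifs <;> first | omega | simp only [mul_assoc]

theorem mergeArg_mergeArg (mul : Ω → Ω → A →ₗ[k] A →ₗ[k] A) (p q : Ω → A →ₗ[k] A)
    (hpq : ∀ α β x, p α (q β x) = q β (p α x))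
    (hpmul : ∀ α β x y, p (α * β) (mul α β x y) = mul α β (p α x) (p β y))
    (hqmul : ∀ α β x y, q (α * β) (mul α β x y) = mul α β (q α x) (q β y))
    (hassoc : ∀ α β γ x y z,
      mul α (β * γ) (p α x) (mul β γ y z) = mul (α * β) γ (mul α β x y) (q γ z))
    {n : ℕ} (i j : Fin n) (hij : i ≤ j) (v : Fin (n + 2) → Ω) (a : Fin (n + 2) → A) :
    mergeArg mul p q j (mergeOmega i.castSucc v) (mergeArg mul p q i.castSucc v a) =
      mergeArg mul p q i (mergeOmega j.succ v) (mergeArg mul p q j.succ v a) := by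
  funext t
  have hij' : (i : ℕ) ≤ j := hij
  simp only [mergeArg, mergeOmega, Fin.val_castSucc, Fin.val_succ, Fin.succ_castSucc]
  split_ifs <;> first | omega | simp only [hpq, hpmul, hqmul, hassoc]

theorem mergeOmega_zero_zero {n : ℕ} (v : Fin (n + 2) → Ω) :
    mergeOmega 0 v 0 = v 0 * v 1 := by
  simp [mergeOmega]

theorem mergeOmega_zero_succ {n : ℕ} (v : Fin (n + 2) → Ω) (j : Fin n) :
    mergeOmega 0 v j.succ = v j.succ.succ := by
  simp [mergeOmega]

theorem mergeOmega_succ_zero {n : ℕ} (i : Fin n) (v : Fin (n + 2) → Ω) :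
    mergeOmega i.succ v 0 = v 0 := by
  simp [mergeOmega]

theorem mergeOmega_succ_succ {n : ℕ} (i : Fin n) (v : Fin (n + 2) → Ω) (j : Fin n) :
    mergeOmega i.succ v j.succ = mergeOmega i (fun t => v t.succ) j := by
  simp [mergeOmega]

theorem mergeOmega_castSucc_last {n : ℕ} (i : Fin n) (v : Fin (n + 2) → Ω) :
    mergeOmega i.castSucc v (Fin.last n) = v (Fin.last (n + 1)) := by
  have := i.isLt
  simp [mergeOmega, this.ne', this.le]

theorem mergeOmega_castSucc_castSucc {n : ℕ} (i : Fin n) (v : Fin (n + 2) → Ω) (j : Fin n) :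
    mergeOmega i.castSucc v j.castSucc = mergeOmega i (fun t => v t.castSucc) j := by
  simp [mergeOmega]

theorem mergeOmega_last_last {n : ℕ} (v : Fin (n + 2) → Ω) :
    mergeOmega (Fin.last n) v (Fin.last n) =
      v (Fin.last n).castSucc * v (Fin.last (n + 1)) := by
  simp [mergeOmega]

theorem mergeOmega_last_castSucc {n : ℕ} (v : Fin (n + 2) → Ω) (j : Fin n) :
    mergeOmega (Fin.last n) v j.castSucc = v j.castSucc.castSucc := by
  simp [mergeOmega]

theorem prod_ofFn_mergeOmega {n : ℕ} (i : Fin n) (v : Fin (n + 1) → Ω) :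
    (List.ofFn (mergeOmega i v)).prod = (List.ofFn v).prod := by
  induction n with
  | zero => exact i.elim0
  | succ n ih =>
    rw [List.ofFn_succ, List.ofFn_succ (f := v), List.prod_cons, List.prod_cons]
    cases i using Fin.cases with
    | zero =>
      simp only [mergeOmega_zero_zero, mergeOmega_zero_succ]
      rw [List.ofFn_succ (f := fun t : Fin (n + 1) => v t.succ), List.prod_cons, mul_assoc]
      rfl
    | succ i =>
      simp only [mergeOmega_succ_zero, mergeOmega_succ_succ]
      rw [← ih i]

section MergeArg

variable {S : Type*} (mul : S → S → A →ₗ[k] A →ₗ[k] A) (p q : S → A →ₗ[k] A) {n : ℕ}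
  (v : Fin (n + 2) → S) (a : Fin (n + 2) → A)

theorem mergeArg_zero_zero :
    mergeArg mul p q 0 v a 0 = mul (v 0) (v 1) (a 0) (a 1) := by
  simp [mergeArg]

theorem mergeArg_zero_succ (j : Fin n) :
    mergeArg mul p q 0 v a j.succ = q (v j.succ.succ) (a j.succ.succ) := by
  simp [mergeArg]

theorem mergeArg_succ_zero (i : Fin n) :
    mergeArg mul p q i.succ v a 0 = p (v 0) (a 0) := by
  simp [mergeArg]

theorem mergeArg_succ_succ (i j : Fin n) :
    mergeArg mul p q i.succ v a j.succ =
      mergeArg mul p q i (fun t => v t.succ) (fun t => a t.succ) j := by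
  simp [mergeArg]

theorem mergeArg_castSucc_last (i : Fin n) :
    mergeArg mul p q i.castSucc v a (Fin.last n) =
      q (v (Fin.last (n + 1))) (a (Fin.last (n + 1))) := by
  have := i.isLt
  simp [mergeArg, this.ne', this.le]

theorem mergeArg_castSucc_castSucc (i j : Fin n) :
    mergeArg mul p q i.castSucc v a j.castSucc =
      mergeArg mul p q i (fun t => v t.castSucc) (fun t => a t.castSucc) j := by
  simp [mergeArg]

theorem mergeArg_last_last :
    mergeArg mul p q (Fin.last n) v a (Fin.last n) =
      mul (v (Fin.last n).castSucc) (v (Fin.last (n + 1)))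
        (a (Fin.last n).castSucc) (a (Fin.last (n + 1))) := by
  simp [mergeArg]

theorem mergeArg_last_castSucc (j : Fin n) :
    mergeArg mul p q (Fin.last n) v a j.castSucc =
      p (v j.castSucc.castSucc) (a j.castSucc.castSucc) := by
  simp [mergeArg]

end MergeArg

theorem iterate_twisted_map_mul (mul : Ω → Ω → A →ₗ[k] A →ₗ[k] A) (s : Ω → A →ₗ[k] A)
    (h : ∀ α β x y, s (α * β) (mul α β x y) = mul α β (s α x) (s β y))
    (m : ℕ) (α β : Ω) (x y : A) :
    (⇑(s (α * β)))^[m] (mul α β x y) = mul α β ((⇑(s α))^[m] x) ((⇑(s β))^[m] y) := by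
  induction m with
  | zero => rfl
  | succ m ih => simp only [Function.iterate_succ_apply', ih, h]

/-- A double alternating sum satisfying the simplicial-type relation vanishes. -/
theorem sum_alternating_eq_zero {n : ℕ} (g : Fin (n + 1) → Fin n → M)
    (hg : ∀ i j : Fin n, i ≤ j → g i.castSucc j = g j.succ i) :
    ∑ i : Fin (n + 1), ((-1 : ℤ) ^ ((i : ℕ) + 1)) •
      ∑ j : Fin n, ((-1 : ℤ) ^ ((j : ℕ) + 1)) • g i j = 0 := by
  induction n with
  | zero => simp
  | succ n ih =>
    have h0 : ∀ j : Fin (n + 1), g 0 j = g j.succ 0 := fun j => hg 0 j (Fin.zero_le j)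
    have h := ih (fun i j => g i.succ j.succ) fun i j hij => by
      have := hg i.succ j.succ (Fin.succ_le_succ_iff.mpr hij)
      simpa only [Fin.succ_castSucc] using this
    have hs : ∀ i : Fin (n + 1),
        ((-1 : ℤ) ^ ((i.succ : ℕ) + 1)) •
            ∑ j : Fin (n + 1), ((-1 : ℤ) ^ ((j : ℕ) + 1)) • g i.succ j =
          ((-1 : ℤ) ^ ((i : ℕ) + 1)) • g i.succ 0 +
            ((-1 : ℤ) ^ ((i : ℕ) + 1)) •
              ∑ j : Fin n, ((-1 : ℤ) ^ ((j : ℕ) + 1)) • g i.succ j.succ := fun i => by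
      rw [Fin.sum_univ_succ]
      simp [pow_succ, Finset.sum_neg_distrib]
    rw [Fin.sum_univ_succ, Finset.sum_congr rfl fun i _ => hs i, Finset.sum_add_distrib, h]
    simp [h0]

theorem prod_ofFn_castSucc_mul_last {n : ℕ} (v : Fin (n + 1) → Ω) :
    (List.ofFn fun j : Fin n => v j.castSucc).prod * v (Fin.last n) = (List.ofFn v).prod := by
  rw [List.ofFn_succ' v, List.prod_concat]

theorem mul_prod_ofFn_succ {n : ℕ} (v : Fin (n + 1) → Ω) :
    v 0 * (List.ofFn fun j : Fin n => v j.succ).prod = (List.ofFn v).prod := by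
  rw [List.ofFn_succ (f := v), List.prod_cons]

/-- For a BiHom-`Ω`-associative algebra `A` and a bimodule `M`
over it, the coboundary operator `δ_Alg` satisfies `δ^{n+1}_Alg ∘ δ^n_Alg = 0` on
`C^n_Ω(A, M)` for all `n ≥ 1`. -/
theorem dAlg_dAlg_eq_zero
    (mul : Ω → Ω → A →ₗ[k] A →ₗ[k] A) (p q : Ω → A →ₗ[k] A)
    (l : Ω → Ω → A →ₗ[k] M →ₗ[k] M) (r : Ω → Ω → M →ₗ[k] A →ₗ[k] M)
    (pM qM : Ω → M →ₗ[k] M)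
    -- `(A, mul, p, q)` is a BiHom-`Ω`-associative algebra
    (hpq : ∀ α β x, p α (q β x) = q β (p α x))
    (hpmul : ∀ α β x y, p (α * β) (mul α β x y) = mul α β (p α x) (p β y))
    (hqmul : ∀ α β x y, q (α * β) (mul α β x y) = mul α β (q α x) (q β y))
    (hassoc : ∀ α β γ x y z,
      mul α (β * γ) (p α x) (mul β γ y z) = mul (α * β) γ (mul α β x y) (q γ z))
    -- `M` is a bimodule over `A`
    (hpl : ∀ α β x m, pM (α * β) (l α β x m) = l α β (p α x) (pM β m))
    (hql : ∀ α β x m, qM (α * β) (l α β x m) = l α β (q α x) (qM β m))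
    (hll : ∀ α β γ x x' m,
      l α (β * γ) (p α x) (l β γ x' m) = l (α * β) γ (mul α β x x') (qM γ m))
    (hpr : ∀ α β m x, pM (α * β) (r α β m x) = r α β (pM α m) (p β x))
    (hqr : ∀ α β m x, qM (α * β) (r α β m x) = r α β (qM α m) (q β x))
    (hrr : ∀ α β γ m x x',
      r α (β * γ) (pM α m) (mul β γ x x') = r (α * β) γ (r α β m x) (q γ x'))
    (hlr : ∀ α β γ x m x',
      l α (β * γ) (p α x) (r β γ m x') = r (α * β) γ (l α β x m) (q γ x'))
    (n : ℕ) (hn : 1 ≤ n)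
    -- an `n`-cochain in `C^n_Ω(A, M)`: a family of multilinear maps compatible
    -- with the structure maps
    (f : (Fin n → Ω) → MultilinearMap k (fun _ : Fin n => A) M)
    (hfp : ∀ (ᾱ : Fin n → Ω) (a : Fin n → A),
      pM (List.ofFn ᾱ).prod (f ᾱ a) = f ᾱ (fun j => p (ᾱ j) (a j)))
    (hfq : ∀ (ᾱ : Fin n → Ω) (a : Fin n → A),
      qM (List.ofFn ᾱ).prod (f ᾱ a) = f ᾱ (fun j => q (ᾱ j) (a j))) :
    ∀ (ᾱ : Fin (n + 2) → Ω) (a : Fin (n + 2) → A),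
      dAlg mul p q l r (n + 1)
        (dAlg mul p q l r n (fun β b => f β b)) ᾱ a = 0 := by
  intro v a
  obtain ⟨m, rfl⟩ : ∃ m, n = m + 1 := ⟨n - 1, by omega⟩
  have interior := sum_alternating_eq_zero
    (fun i j => f (mergeOmega j (mergeOmega i v))
      (mergeArg mul p q j (mergeOmega i v) (mergeArg mul p q i v a)))
    fun i j hij => by
      rw [mergeOmega_mergeOmega i j hij,
        mergeArg_mergeArg mul p q hpq hpmul hqmul hassoc i j hij]
  have left_left :
      l (v 0) (List.ofFn fun j : Fin (m + 2) => v j.succ).prod ((⇑(p (v 0)))^[m + 1] (a 0))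
          (l (v (Fin.succ 0)) (List.ofFn fun j : Fin (m + 1) => v j.succ.succ).prod
            ((⇑(p (v (Fin.succ 0))))^[m] (a (Fin.succ 0)))
            (f (fun j => v j.succ.succ) fun j => a j.succ.succ)) =
        l (mergeOmega 0 v 0) (List.ofFn fun j : Fin (m + 1) => mergeOmega 0 v j.succ).prod
          ((⇑(p (mergeOmega 0 v 0)))^[m] (mergeArg mul p q 0 v a 0))
          (f (fun j => mergeOmega 0 v j.succ) fun j => mergeArg mul p q 0 v a j.succ) := by
    simp only [mergeOmega_zero_zero, mergeOmega_zero_succ, mergeArg_zero_zero,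
      mergeArg_zero_succ, iterate_twisted_map_mul mul p hpmul, ← hfq]
    rw [← mul_prod_ofFn_succ fun j : Fin (m + 2) => v j.succ, Function.iterate_succ_apply', hll]
    rfl
  have left_merge : ∀ i : Fin (m + 1),
      l (mergeOmega i.succ v 0)
          (List.ofFn fun j : Fin (m + 1) => mergeOmega i.succ v j.succ).prod
          ((⇑(p (mergeOmega i.succ v 0)))^[m] (mergeArg mul p q i.succ v a 0))
          (f (fun j => mergeOmega i.succ v j.succ) fun j => mergeArg mul p q i.succ v a j.succ) =
        l (v 0) (List.ofFn fun j : Fin (m + 2) => v j.succ).prod ((⇑(p (v 0)))^[m + 1] (a 0))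
          (f (mergeOmega i fun j => v j.succ)
            (mergeArg mul p q i (fun j => v j.succ) fun j => a j.succ)) := fun i => by
    simp only [mergeOmega_succ_zero, mergeOmega_succ_succ, mergeArg_succ_zero,
      mergeArg_succ_succ, prod_ofFn_mergeOmega, Function.iterate_succ_apply]
  have left_right :
      l (v 0) (List.ofFn fun j : Fin (m + 2) => v j.succ).prod ((⇑(p (v 0)))^[m + 1] (a 0))
          (r (List.ofFn fun j : Fin (m + 1) => v j.castSucc.succ).prod
            (v (Fin.last (m + 1)).succ)
            (f (fun j => v j.castSucc.succ) fun j => a j.castSucc.succ)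
            ((⇑(q (v (Fin.last (m + 1)).succ)))^[m] (a (Fin.last (m + 1)).succ))) =
        r (List.ofFn fun j : Fin (m + 2) => v j.castSucc).prod (v (Fin.last (m + 2)))
          (l (v (Fin.castSucc 0)) (List.ofFn fun j : Fin (m + 1) => v j.succ.castSucc).prod
            ((⇑(p (v (Fin.castSucc 0))))^[m] (a (Fin.castSucc 0)))
            (f (fun j => v j.succ.castSucc) fun j => a j.succ.castSucc))
          ((⇑(q (v (Fin.last (m + 2)))))^[m + 1] (a (Fin.last (m + 2)))) := by
    rw [← prod_ofFn_castSucc_mul_last fun j : Fin (m + 2) => v j.succ,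
      ← mul_prod_ofFn_succ fun j : Fin (m + 2) => v j.castSucc,
      Function.iterate_succ_apply', Function.iterate_succ_apply', hlr]
    rfl
  have right_merge : ∀ i : Fin (m + 1),
      r (List.ofFn fun j : Fin (m + 1) => mergeOmega i.castSucc v j.castSucc).prod
          (mergeOmega i.castSucc v (Fin.last (m + 1)))
          (f (fun j => mergeOmega i.castSucc v j.castSucc)
            fun j => mergeArg mul p q i.castSucc v a j.castSucc)
          ((⇑(q (mergeOmega i.castSucc v (Fin.last (m + 1)))))^[m]
            (mergeArg mul p q i.castSucc v a (Fin.last (m + 1)))) =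
        r (List.ofFn fun j : Fin (m + 2) => v j.castSucc).prod (v (Fin.last (m + 2)))
          (f (mergeOmega i fun j => v j.castSucc)
            (mergeArg mul p q i (fun j => v j.castSucc) fun j => a j.castSucc))
          ((⇑(q (v (Fin.last (m + 2)))))^[m + 1] (a (Fin.last (m + 2)))) := fun i => by
    simp only [mergeOmega_castSucc_last, mergeOmega_castSucc_castSucc, mergeArg_castSucc_last,
      mergeArg_castSucc_castSucc, prod_ofFn_mergeOmega, Function.iterate_succ_apply]
  have right_right :
      r (List.ofFn fun j : Fin (m + 2) => v j.castSucc).prod (v (Fin.last (m + 2)))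
          (r (List.ofFn fun j : Fin (m + 1) => v j.castSucc.castSucc).prod
            (v (Fin.last (m + 1)).castSucc)
            (f (fun j => v j.castSucc.castSucc) fun j => a j.castSucc.castSucc)
            ((⇑(q (v (Fin.last (m + 1)).castSucc)))^[m] (a (Fin.last (m + 1)).castSucc)))
          ((⇑(q (v (Fin.last (m + 2)))))^[m + 1] (a (Fin.last (m + 2)))) =
        r (List.ofFn fun j : Fin (m + 1) => mergeOmega (Fin.last (m + 1)) v j.castSucc).prod
          (mergeOmega (Fin.last (m + 1)) v (Fin.last (m + 1)))
          (f (fun j => mergeOmega (Fin.last (m + 1)) v j.castSucc)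
            fun j => mergeArg mul p q (Fin.last (m + 1)) v a j.castSucc)
          ((⇑(q (mergeOmega (Fin.last (m + 1)) v (Fin.last (m + 1)))))^[m]
            (mergeArg mul p q (Fin.last (m + 1)) v a (Fin.last (m + 1)))) := by
    simp only [mergeOmega_last_last, mergeOmega_last_castSucc, mergeArg_last_last,
      mergeArg_last_castSucc, iterate_twisted_map_mul mul q hqmul, ← hfp]
    rw [← prod_ofFn_castSucc_mul_last fun j : Fin (m + 2) => v j.castSucc,
      Function.iterate_succ_apply', hrr]
  simp only [dAlg, Nat.add_sub_cancel, map_add, map_sum, map_zsmul, LinearMap.add_apply,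
    LinearMap.sum_apply, LinearMap.smul_apply, smul_add, Finset.sum_add_distrib, interior]
  rw [left_left, left_right, right_right, Fin.sum_univ_succ (n := m + 1),
    Fin.sum_univ_castSucc (n := m + 1)]
  simp only [left_merge, right_merge, Fin.val_zero, Fin.val_succ, Fin.val_castSucc, Fin.val_last]
  rcases neg_one_pow_eq_or ℤ m with h | h <;>
  · simp only [pow_succ, h, mul_neg, mul_one, neg_neg, neg_smul, smul_neg, pow_zero, one_smul,
      Finset.sum_neg_distrib]
    abel

end
end

section
/- Let (A, μ_{α,β}, p_ω, q_ω) be a BiHom-Ω-associative algebra and let (N_ω)_{ω∈Ω} : A → A be a Nijenhuis family, i.e., N_α p_α = p_α N_α, N_α q_α = q_α N_α, and μ_{α,β}(N_α(a), N_β(b)) = N_{αβ}(μ_{α,β}(a, N_β(b)) + μ_{α,β}(N_α(a), b) − N_{αβ} μ_{α,β}(a,b)). Define μ^N_{α,β}(a,b) := μ_{α,β}(N_α(a), b) + μ_{α,β}(a, N_β(b)) − N_{αβ} μ_{α,β}(a,b). Then (A, μ^N_{α,β}, p_ω, q_ω) is a BiHom-Ω-associative algebra. -/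
/-- The product deformed by a Nijenhuis family:
`μ^N_{α,β}(a,b) = μ_{α,β}(N_α a, b) + μ_{α,β}(a, N_β b) − N_{αβ} μ_{α,β}(a,b)`. -/
def nijMul {k Ω A : Type*} [CommRing k] [Semigroup Ω]
    [AddCommGroup A] [Module k A]
    (mul : Ω → Ω → A →ₗ[k] A →ₗ[k] A) (N : Ω → A →ₗ[k] A)
    (α β : Ω) : A →ₗ[k] A →ₗ[k] A :=
  (mul α β).comp (N α) + (mul α β).compl₂ (N β) - (mul α β).compr₂ (N (α * β))

theorem nijMul_apply {k Ω A : Type*} [CommRing k] [Semigroup Ω] [AddCommGroup A] [Module k A]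
    (mul : Ω → Ω → A →ₗ[k] A →ₗ[k] A) (N : Ω → A →ₗ[k] A) (α β : Ω) (a b : A) :
    nijMul mul N α β a b
      = mul α β (N α a) b + mul α β a (N β b) - N (α * β) (mul α β a b) :=
  rfl

/-- If `(N_ω)` is a Nijenhuis family on a BiHom-`Ω`-associative
algebra `(A, μ, p, q)`, then `(A, μ^N, p, q)` is a BiHom-`Ω`-associative algebra. -/
theorem nijMul_isBiHomAssoc
    {k Ω A : Type*} [CommRing k] [Semigroup Ω] [AddCommGroup A] [Module k A]
    (mul : Ω → Ω → A →ₗ[k] A →ₗ[k] A) (N p q : Ω → A →ₗ[k] A)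
    (hA : IsBiHomAssoc mul p q)
    (hNp : ∀ ω x, N ω (p ω x) = p ω (N ω x))
    (hNq : ∀ ω x, N ω (q ω x) = q ω (N ω x))
    (hNij : ∀ α β a b,
      mul α β (N α a) (N β b)
        = N (α * β) (mul α β a (N β b) + mul α β (N α a) b
            - N (α * β) (mul α β a b))) :
    IsBiHomAssoc (nijMul mul N) p q := by
  obtain ⟨hpq, hp, hq, hassoc⟩ := hA
  have hN : ∀ α β a b, N (α * β) (nijMul mul N α β a b) = mul α β (N α a) (N β b) := by
    intro α β a b
    rw [hNij, nijMul_apply, add_comm (mul α β (N α a) b)]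
  refine ⟨hpq, fun α β x y => ?_, fun α β x y => ?_, fun α β γ x y z => ?_⟩
  · simp only [nijMul_apply, map_add, map_sub, hp, hNp, ← hNp (α * β)]
  · simp only [nijMul_apply, map_add, map_sub, hq, hNq, ← hNq (α * β)]
  · have hl := hNij α (β * γ) (p α x) (mul β γ y z)
    have hr := hNij (α * β) γ (mul α β x y) (q γ z)
    rw [nijMul_apply, nijMul_apply mul N (α * β) γ, hN, hN]
    simp only [nijMul_apply, map_add, map_sub, LinearMap.add_apply, LinearMap.sub_apply,
      hNp, hNq, hassoc, mul_assoc] at hl hr ⊢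
    rw [hl, hr]
    abel
end

section
/- Let (A, μ_{α,β}, p_ω, q_ω) be a BiHom-Ω-associative algebra and (N_ω) a Nijenhuis family on A, with μ^N defined as the deformed product. Then μ^t_{α,β} := μ_{α,β} + t μ^N_{α,β} makes A[[t]]/(t²) a BiHom-Ω-associative algebra; equivalently, the three identities hold: (i) μ_{αβ,γ}(μ_{α,β}(a,b), q_γ(c)) = μ_{α,βγ}(p_α(a), μ_{β,γ}(b,c)); (ii) μ_{αβ,γ}(μ^N_{α,β}(a,b), q_γ(c)) + μ^N_{αβ,γ}(μ_{α,β}(a,b), q_γ(c)) = μ_{α,βγ}(p_α(a), μ^N_{β,γ}(b,c)) + μ^N_{α,βγ}(p_α(a), μ_{β,γ}(b,c)); (iii) μ^N_{αβ,γ}(μ^N_{α,β}(a,b), q_γ(c)) = μ^N_{α,βγ}(p_α(a), μ^N_{β,γ}(b,c)), for all a,b,c ∈ A and α,β,γ ∈ Ω. -/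
/-- For a Nijenhuis family `(N_ω)` on a BiHom-`Ω`-associative
algebra `(A, μ, p, q)`, the product `μ^t = μ + t μ^N` makes `A[[t]]/(t²)` a
BiHom-`Ω`-associative algebra; equivalently, the three identities obtained by
comparing coefficients of `1`, `t`, `t²` hold. -/
theorem nijenhuis_linear_deformation
    {k Ω A : Type*} [CommRing k] [Semigroup Ω] [AddCommGroup A] [Module k A]
    (mul : Ω → Ω → A →ₗ[k] A →ₗ[k] A) (N p q : Ω → A →ₗ[k] A)
    -- `(A, mul, p, q)` is a BiHom-`Ω`-associative algebra
    (hpq : ∀ α β x, p α (q β x) = q β (p α x))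
    (hpmul : ∀ α β x y, p (α * β) (mul α β x y) = mul α β (p α x) (p β y))
    (hqmul : ∀ α β x y, q (α * β) (mul α β x y) = mul α β (q α x) (q β y))
    (hassoc : ∀ α β γ x y z,
      mul α (β * γ) (p α x) (mul β γ y z) = mul (α * β) γ (mul α β x y) (q γ z))
    -- `(N_ω)` is a Nijenhuis family
    (hNp : ∀ ω x, N ω (p ω x) = p ω (N ω x))
    (hNq : ∀ ω x, N ω (q ω x) = q ω (N ω x))
    (hNij : ∀ α β a b,
      mul α β (N α a) (N β b)
        = N (α * β) (mul α β (N α a) b + mul α β a (N β b)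
            - N (α * β) (mul α β a b))) :
    -- (i) coefficient of `1`
    (∀ α β γ a b c,
      mul (α * β) γ (mul α β a b) (q γ c)
        = mul α (β * γ) (p α a) (mul β γ b c)) ∧
    -- (ii) coefficient of `t`
    (∀ α β γ a b c,
      mul (α * β) γ (nijMul mul N α β a b) (q γ c)
          + nijMul mul N (α * β) γ (mul α β a b) (q γ c)
        = mul α (β * γ) (p α a) (nijMul mul N β γ b c)
          + nijMul mul N α (β * γ) (p α a) (mul β γ b c)) ∧
    -- (iii) coefficient of `t²`
    (∀ α β γ a b c,
      nijMul mul N (α * β) γ (nijMul mul N α β a b) (q γ c)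
        = nijMul mul N α (β * γ) (p α a) (nijMul mul N β γ b c)) := by
  refine ⟨fun α β γ a b c => (hassoc α β γ a b c).symm, fun α β γ a b c => ?_,
    fun α β γ a b c => ?_⟩
  · simp only [nijMul_apply, map_add, map_sub, LinearMap.add_apply, LinearMap.sub_apply,
      hNp, hNq, hassoc, mul_assoc]
    abel
  · have hN : ∀ α β a b, N (α * β) (nijMul mul N α β a b) = mul α β (N α a) (N β b) :=
      fun α β a b => (hNij α β a b).symm
    have hl := hNij (α * β) γ (mul α β a b) (q γ c)
    have hr := hNij α (β * γ) (p α a) (mul β γ b c)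
    rw [nijMul_apply, nijMul_apply mul N α (β * γ), hN, hN]
    simp only [nijMul_apply, map_add, map_sub, LinearMap.add_apply, LinearMap.sub_apply,
      hNp, hNq, hassoc, mul_assoc] at hl hr ⊢
    rw [hl, hr]
    abel
end
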